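/- Let P ⊆ ℝ^n be a pointed polyhedron with the integer decomposition property, where aff(P) = {x : Ax = b} for A ∈ ℤ^{m×n}, b ∈ ℤ^m, m ≥ 1, b ≠ 0, and gcd of the entries of b equals 1. Then P ∩ ℤ^n contains a linearly independent subset B such that every integral vector in lin(P) is an integral linear combination of B. -/

import Mathlib

open scoped Classical

noncomputable section

/-- `scaleSet k P` is the set `kP` of sums `∑ λ_p • p` over finitely many points of `P`
with `λ ≥ 0` and `∑ λ_p = k`. -/
def scaleSet {n : ℕ} (k : ℝ) (P : Set (Fin n → ℝ)) : Set (Fin n → ℝ) :=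
  {x | ∃ (s : Finset (Fin n → ℝ)) (c : (Fin n → ℝ) → ℝ),
    (↑s ⊆ P) ∧ (∀ p, 0 ≤ c p) ∧ (∑ p ∈ s, c p = k) ∧ x = ∑ p ∈ s, c p • p}

/-- The integer decomposition property. -/
def IDP {n : ℕ} (P : Set (Fin n → ℝ)) : Prop :=
  ∀ k : ℕ, 1 ≤ k → ∀ x : Fin n → ℤ,
    (fun i => (x i : ℝ)) ∈ scaleSet (k : ℝ) P →
    ∃ f : Fin k → (Fin n → ℤ), (∀ i, (fun j => (f i j : ℝ)) ∈ P) ∧ x = ∑ i, f i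

/-- A set is pointed if it contains no line. -/
def IsPointed {n : ℕ} (P : Set (Fin n → ℝ)) : Prop :=
  ¬ ∃ (x d : Fin n → ℝ), d ≠ 0 ∧ ∀ t : ℝ, (x + t • d) ∈ P

theorem Convex.exists_add_smul_int_mem {q : ℕ} {O : Set (Fin q → ℝ)} (hO : Convex ℝ O)
    (hint : (interior O).Nonempty) (hunb : ¬ Bornology.IsBounded O) {L : ℝ} (hL : 0 < L) :
    ∃ a ∈ O, ∃ w : Fin q → ℤ, w ≠ 0 ∧ a + L • (fun i => (w i : ℝ)) ∈ O := by
  obtain ⟨z, hz⟩ := hint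
  obtain ⟨ρ, hρ, hball⟩ := Metric.isOpen_iff.1 isOpen_interior z hz
  have hball' : Metric.ball z ρ ⊆ O := hball.trans interior_subset
  have hfar : ∀ k : ℝ, ∃ y ∈ O, k < ‖y‖ := by
    intro k
    by_contra! h
    exact hunb (isBounded_iff_forall_norm_le.2 ⟨k, h⟩)
  choose y hyO hy using fun k : ℕ => hfar k
  let m : ℕ → (Fin q → ℝ) := fun k => (1 / 2 : ℝ) • z + (1 / 2 : ℝ) • y k
  have hm : ∀ k, ∀ d : Fin q → ℝ, ‖d‖ < ρ / 2 → m k + d ∈ O := by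
    intro k d hd
    have h1 : z + (2 : ℝ) • d ∈ O := hball' (by
      rw [Metric.mem_ball, dist_eq_norm, add_sub_cancel_left, norm_smul]
      norm_num; linarith)
    have h2 := hO h1 (hyO k) (show (0 : ℝ) ≤ 1 / 2 by norm_num) (show (0 : ℝ) ≤ 1 / 2 by norm_num)
      (by norm_num)
    convert h2 using 1
    ext i
    simp [m]
    ring
  let r : (Fin q → ℝ) → (Fin q → ℝ) := fun x i => L * Int.fract (x i / L)
  have hr : Bornology.IsBounded (Set.range fun k => r (m k)) := by
    refine isBounded_iff_forall_norm_le.2 ⟨L, ?_⟩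
    rintro _ ⟨k, rfl⟩
    refine (pi_norm_le_iff_of_nonneg hL.le).2 fun i => ?_
    have h0 := Int.fract_nonneg (m k i / L)
    have h1 := (Int.fract_lt_one (m k i / L)).le
    rw [Real.norm_eq_abs, abs_of_nonneg (by positivity)]
    nlinarith
  obtain ⟨l, -, φ, hφ, hlim⟩ := tendsto_subseq_of_bounded hr (fun k => Set.mem_range_self k)
  obtain ⟨i₀, hi₀⟩ := Metric.tendsto_atTop.1 hlim (ρ / 4) (by positivity)
  obtain ⟨j, hj⟩ : ∃ j : ℕ, i₀ ≤ j ∧ ‖y (φ i₀)‖ + ρ ≤ (φ j : ℝ) := by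
    obtain ⟨t, ht⟩ := exists_nat_ge (‖y (φ i₀)‖ + ρ)
    refine ⟨max i₀ t, le_max_left _ _, ht.trans ?_⟩
    exact_mod_cast (le_max_right i₀ t).trans (hφ.id_le _)
  have hclose : ‖r (m (φ j)) - r (m (φ i₀))‖ < ρ / 2 := by
    rw [← dist_eq_norm]
    have h1 := hi₀ j hj.1
    have h2 := hi₀ i₀ le_rfl
    have h3 := dist_triangle_right (r (m (φ j))) (r (m (φ i₀))) l
    simp only [Function.comp] at h1 h2
    linarith
  let w : Fin q → ℤ := fun i => ⌊m (φ j) i / L⌋ - ⌊m (φ i₀) i / L⌋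
  have hw : m (φ i₀) + L • (fun i => (w i : ℝ)) =
      m (φ j) + -(r (m (φ j)) - r (m (φ i₀))) := by
    ext i
    have e : ∀ x : ℝ, L * Int.fract (x / L) = x - L * ⌊x / L⌋ := by
      intro x; rw [Int.fract]; field_simp
    simp only [Pi.add_apply, Pi.smul_apply, smul_eq_mul, Pi.neg_apply, Pi.sub_apply, w, r, e]
    push_cast; ring
  refine ⟨m (φ i₀), by simpa using hm (φ i₀) 0 (by simpa using hρ), w, ?_, ?_⟩
  · intro h0
    have h1 : m (φ j) - m (φ i₀) = r (m (φ j)) - r (m (φ i₀)) := by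
      have : (L • (fun i => (w i : ℝ))) = 0 := by ext i; simp [h0]
      rw [this, add_zero] at hw
      linear_combination -hw
    have h2 : m (φ j) - m (φ i₀) = (1 / 2 : ℝ) • (y (φ j) - y (φ i₀)) := by
      simp only [m, smul_sub]; abel
    rw [← h1, h2, norm_smul] at hclose
    have h3 := norm_sub_norm_le (y (φ j)) (y (φ i₀))
    have h4 := hy (φ j)
    norm_num at hclose
    linarith [hj.2]
  · rw [hw]
    exact hm _ _ (by rwa [norm_neg])

theorem exists_linearEquiv_smul_single {q : ℕ} {w : Fin (q + 1) → ℤ} (hw : w ≠ 0) :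
    ∃ (e : (Fin (q + 1) → ℤ) ≃ₗ[ℤ] (Fin (q + 1) → ℤ)) (k : ℤ),
      k ≠ 0 ∧ w = k • e (Pi.single 0 1) := by
  obtain ⟨n, S⟩ := Submodule.smithNormalForm (Pi.basisFun ℤ (Fin (q + 1)))
    (Submodule.span ℤ {w})
  obtain ⟨i⟩ : Nonempty (Fin n) := by
    by_contra h
    rw [not_nonempty_iff] at h
    have h1 : (⟨w, Submodule.mem_span_singleton_self w⟩ : Submodule.span ℤ {w}) = 0 :=
      S.bN.ext_elem fun i => h.elim i
    exact hw (congrArg Subtype.val h1)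
  obtain ⟨t, ht⟩ := Submodule.mem_span_singleton.1 (S.bN i).2
  have ht0 : t ≠ 0 := by
    rintro rfl
    have : S.bN i = 0 := Subtype.ext (by rw [← ht, zero_smul]; rfl)
    exact S.bN.ne_zero i this
  let b := S.bM.reindex (Equiv.swap (S.f i) 0)
  have hb : b 0 = S.bM (S.f i) := by simp [b]
  have hwb : w = (S.bM.repr w (S.f i)) • b 0 := by
    rw [hb]
    refine S.bM.ext_elem fun j => ?_
    have h1 := congrArg (fun x => S.bM.repr x j) (ht.trans (S.snf i))
    simp only [map_smul, Finsupp.smul_apply, Module.Basis.repr_self, Finsupp.single_apply,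
      smul_eq_mul] at h1 ⊢
    by_cases hj : S.f i = j
    · simp [hj]
    · simpa [hj, ht0] using h1
  refine ⟨(b.equivFun).symm, S.bM.repr w (S.f i), ?_, ?_⟩
  · intro h; rw [h, zero_smul] at hwb; exact hw hwb
  · rw [Module.Basis.equivFun_symm_apply]
    simpa [Pi.single_apply] using hwb

/-- The inclusion of `ℤ^q` in `ℝ^q`. -/
def realVec {q : ℕ} (v : Fin q → ℤ) : Fin q → ℝ := fun i => (v i : ℝ)

@[simp]
theorem realVec_apply {q : ℕ} (v : Fin q → ℤ) (i : Fin q) : realVec v i = (v i : ℝ) := rfl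

theorem realVec_add {q : ℕ} (v w : Fin q → ℤ) : realVec (v + w) = realVec v + realVec w := by
  ext i; simp

theorem realVec_single {q : ℕ} (i : Fin q) : realVec (Pi.single i 1) = Pi.single i 1 := by
  ext j
  by_cases h : j = i
  · subst h; simp
  · simp [h]

theorem realVec_mulVec {m q : ℕ} (M : Matrix (Fin m) (Fin q) ℤ) (v : Fin q → ℤ) :
    realVec (M.mulVec v) = (M.map (Int.cast : ℤ → ℝ)).mulVec (realVec v) :=
  funext fun j => RingHom.map_mulVec (Int.castRingHom ℝ) M v j

theorem realVec_vecMul {q : ℕ} (M : Matrix (Fin q) (Fin q) ℤ) (v : Fin q → ℤ) :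
    realVec (Matrix.vecMul v M) = Matrix.vecMul (realVec v) (M.map (Int.cast : ℤ → ℝ)) :=
  funext fun j => RingHom.map_vecMul (Int.castRingHom ℝ) M v j

theorem Matrix.map_intCast_mul_eq_one {q : ℕ} {M M' : Matrix (Fin q) (Fin q) ℤ}
    (h : M * M' = 1) : M.map (Int.cast : ℤ → ℝ) * M'.map (Int.cast : ℤ → ℝ) = 1 := by
  have h1 := congrArg (Int.castRingHom ℝ).mapMatrix h
  rw [map_mul, map_one] at h1
  exact h1

/-- No nonzero integral linear functional is bounded on `O`. -/
def InfiniteWidth {q : ℕ} (O : Set (Fin q → ℝ)) : Prop :=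
  ∀ m : Fin q → ℤ, m ≠ 0 → ¬ ∃ A : ℝ, ∀ x ∈ O, |realVec m ⬝ᵥ x| ≤ A

/-- `O` contains a copy, dilated by `N` and translated, of a family spanning `ℤ^q`
together with the origin. -/
def ContainsDilate {q : ℕ} (O : Set (Fin q → ℝ)) (N : ℝ) : Prop :=
  ∃ x ∈ O, ∃ w : Fin q → (Fin q → ℤ), Submodule.span ℤ (Set.range w) = ⊤ ∧
    ∀ i, x + N • realVec (w i) ∈ O

theorem InfiniteWidth.not_isBounded {q : ℕ} {O : Set (Fin (q + 1) → ℝ)} (h : InfiniteWidth O) :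
    ¬ Bornology.IsBounded O := by
  intro hb
  obtain ⟨A, hA⟩ := isBounded_iff_forall_norm_le.1 hb
  refine h (Pi.single 0 1) (by simp) ⟨A, fun x hx => ?_⟩
  rw [realVec_single, single_one_dotProduct]
  exact (norm_le_pi_norm x 0).trans (hA x hx)

theorem exists_containsDilate_cons {q : ℕ}
    (ih : ∀ O : Set (Fin q → ℝ), Convex ℝ O → (interior O).Nonempty → InfiniteWidth O →
      ∀ N : ℝ, 0 < N → ContainsDilate O N)
    {O : Set (Fin (q + 1) → ℝ)} (hO : Convex ℝ O) (hint : (interior O).Nonempty)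
    (hw : InfiniteWidth O) {N : ℝ} (hN : 0 < N) (x₀ : Fin (q + 1) → ℝ)
    (hx₀ : ∀ s : ℝ, |s| ≤ 2 * N → x₀ + s • (Pi.single 0 1) ∈ O) : ContainsDilate O N := by
  let T : (Fin (q + 1) → ℝ) →ₗ[ℝ] (Fin q → ℝ) := LinearMap.funLeft ℝ ℝ Fin.succ
  have hT : Function.Surjective T :=
    LinearMap.funLeft_surjective_of_injective _ _ _ (Fin.succ_injective q)
  have hTint : (interior (T '' O)).Nonempty := by
    have : T '' interior O ⊆ interior (T '' O) :=
      interior_maximal (Set.image_mono interior_subset)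
        (T.isOpenMap_of_finiteDimensional hT _ isOpen_interior)
    exact (hint.image T).mono this
  have hTw : InfiniteWidth (T '' O) := by
    rintro m hm ⟨A, hA⟩
    refine hw (Fin.cons 0 m) ?_ ⟨A, fun x hx => ?_⟩
    · intro h
      apply hm
      ext i
      simpa using congrFun h i.succ
    · have := hA (T x) ⟨x, hx, rfl⟩
      simpa [dotProduct, Fin.sum_univ_succ, T, LinearMap.funLeft] using this
  obtain ⟨_, ⟨a₀, ha₀, rfl⟩, w, hspan, hdil⟩ :=
    ih (T '' O) (hO.linear_image T) hTint hTw (2 * N) (by positivity)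
  choose a ha haT using hdil
  let k : Fin q → ℤ := fun i => ⌊(a i 0 - a₀ 0) / 2 / N⌋
  have hk : ∀ i, |N * k i - (a i 0 - a₀ 0) / 2| ≤ N := by
    intro i
    have h1 := Int.floor_le ((a i 0 - a₀ 0) / 2 / N)
    have h2 := Int.lt_floor_add_one ((a i 0 - a₀ 0) / 2 / N)
    rw [le_div_iff₀ hN] at h1
    rw [div_lt_iff₀ hN] at h2
    rw [abs_le]
    constructor <;> simp only [k] <;> linarith
  have hmid : ∀ y ∈ O, ∀ s : ℝ, |s| ≤ N →
      (1 / 2 : ℝ) • y + (1 / 2 : ℝ) • (x₀ + (2 * s) • Pi.single 0 1) ∈ O := by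
    intro y hy s hs
    refine hO hy (hx₀ _ ?_) (by norm_num) (by norm_num) (by norm_num)
    rw [abs_mul, abs_two]; linarith
  refine ⟨(1 / 2 : ℝ) • a₀ + (1 / 2 : ℝ) • x₀, ?_,
    Fin.cons (Pi.single 0 1) fun i => Fin.cons (k i) (w i), ?_, ?_⟩
  · simpa using hmid a₀ ha₀ 0 (by simpa using hN.le)
  · set S := Submodule.span ℤ (Set.range (Fin.cons (Pi.single 0 1)
      fun i => Fin.cons (k i) (w i) : Fin (q + 1) → (Fin (q + 1) → ℤ))) with hS
    have h0 : (Pi.single 0 1 : Fin (q + 1) → ℤ) ∈ S := Submodule.subset_span ⟨0, by simp⟩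
    let f : (Fin (q + 1) → ℤ) →ₗ[ℤ] (Fin q → ℤ) := LinearMap.funLeft ℤ ℤ Fin.succ
    have hf : S.map f = ⊤ := by
      rw [eq_top_iff, ← hspan, Submodule.span_le]
      rintro _ ⟨i, rfl⟩
      refine ⟨Fin.cons (k i) (w i), Submodule.subset_span ⟨i.succ, by simp⟩, ?_⟩
      ext j; simp [f, LinearMap.funLeft]
    rw [eq_top_iff]
    intro y _
    obtain ⟨s, hs, hsy⟩ : f y ∈ S.map f := hf ▸ Submodule.mem_top
    have : y = s + (y 0 - s 0) • Pi.single 0 1 := by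
      ext j
      refine Fin.cases ?_ (fun j => ?_) j
      · simp
      · simpa [f, LinearMap.funLeft] using (congrFun hsy j).symm
    rw [this]
    exact S.add_mem hs (S.smul_mem _ h0)
  · refine Fin.cases ?_ fun i => ?_
    · convert hmid a₀ ha₀ N (abs_of_pos hN).le using 1
      ext j
      refine Fin.cases ?_ (fun j => ?_) j
      · simp; ring
      · simp
    · convert hmid (a i) (ha i) _ (hk i) using 1
      ext j
      refine Fin.cases ?_ (fun j => ?_) j
      · simp; ring
      · have h1 := congrFun (haT i) j
        simp [T, LinearMap.funLeft] at h1
        simp [h1]; ring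

theorem ContainsDilate.of_preimage {q : ℕ} {O : Set (Fin q → ℝ)} {N : ℝ}
    (M : Matrix (Fin q) (Fin q) ℤ) (hM : Function.Surjective M.mulVec)
    (h : ContainsDilate ((M.map (Int.cast : ℤ → ℝ)).mulVec ⁻¹' O) N) : ContainsDilate O N := by
  obtain ⟨x, hx, w, hspan, hw⟩ := h
  refine ⟨_, hx, fun i => M.mulVec (w i), ?_, fun i => ?_⟩
  · have h1 := congrArg (Submodule.map M.mulVecLin) hspan
    rw [Submodule.map_span, ← Set.range_comp, Submodule.map_top, LinearMap.range_eq_top.2 hM] at h1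
    exact h1
  · have h1 := hw i
    rw [Set.mem_preimage, Matrix.mulVec_add, Matrix.mulVec_smul] at h1
    rw [realVec_mulVec]
    exact h1

theorem InfiniteWidth.preimage {q : ℕ} {O : Set (Fin q → ℝ)} (hO : InfiniteWidth O)
    {M M' : Matrix (Fin q) (Fin q) ℤ} (h : M * M' = 1) (h' : M' * M = 1) :
    InfiniteWidth ((M.map (Int.cast : ℤ → ℝ)).mulVec ⁻¹' O) := by
  rintro m hm ⟨A, hA⟩
  have hr : M.map (Int.cast : ℤ → ℝ) * M'.map (Int.cast : ℤ → ℝ) = 1 := Matrix.map_intCast_mul_eq_one h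
  refine hO (Matrix.vecMul m M') ?_ ⟨A, fun x hx => ?_⟩
  · intro h0
    apply hm
    have := congrArg (fun v => Matrix.vecMul v M) h0
    simpa [h'] using this
  · rw [realVec_vecMul, ← Matrix.dotProduct_mulVec]
    refine hA _ ?_
    rw [Set.mem_preimage, Matrix.mulVec_mulVec, hr, Matrix.one_mulVec]
    exact hx

theorem InfiniteWidth.containsDilate {q : ℕ} {O : Set (Fin q → ℝ)} (hO : Convex ℝ O)
    (hint : (interior O).Nonempty) (hw : InfiniteWidth O) {N : ℝ} (hN : 0 < N) :
    ContainsDilate O N := by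
  induction q generalizing N with
  | zero =>
    obtain ⟨x, hx⟩ := hint
    exact ⟨x, interior_subset hx, Fin.elim0, Subsingleton.elim _ _, fun i => i.elim0⟩
  | succ q ih =>
    obtain ⟨a, ha, w, hw0, haw⟩ := hO.exists_add_smul_int_mem hint hw.not_isBounded
      (show 0 < 4 * N by positivity)
    change a + (4 * N) • realVec w ∈ O at haw
    obtain ⟨e, k, hk, hwk⟩ := exists_linearEquiv_smul_single hw0
    let M := LinearMap.toMatrix' (e : (Fin (q + 1) → ℤ) →ₗ[ℤ] (Fin (q + 1) → ℤ))
    let M' := LinearMap.toMatrix' (e.symm : (Fin (q + 1) → ℤ) →ₗ[ℤ] (Fin (q + 1) → ℤ))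
    have h : M * M' = 1 := by
      simp only [M, M', ← LinearMap.toMatrix'_comp]; simp
    have h' : M' * M = 1 := by
      simp only [M, M', ← LinearMap.toMatrix'_comp]; simp
    have hr : M.map (Int.cast : ℤ → ℝ) * M'.map (Int.cast : ℤ → ℝ) = 1 := Matrix.map_intCast_mul_eq_one h
    have hMe : ∀ v, M.mulVec v = e v := fun v => by simp [M]
    let R : (Fin (q + 1) → ℝ) →ₗ[ℝ] (Fin (q + 1) → ℝ) := (M.map (Int.cast : ℤ → ℝ)).mulVecLin
    let R' : (Fin (q + 1) → ℝ) →ₗ[ℝ] (Fin (q + 1) → ℝ) := (M'.map (Int.cast : ℤ → ℝ)).mulVecLin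
    have hRR' : ∀ x, R (R' x) = x := by
      intro x
      simp [R, R', hr]
    refine ContainsDilate.of_preimage M (fun v => ⟨e.symm v, by rw [hMe]; simp⟩) ?_
    refine exists_containsDilate_cons (fun O h1 h2 h3 N hN => ih h1 h2 h3 hN)
      (hO.linear_preimage R) ?_ (hw.preimage h h') hN
      (R' (a + (2 * N) • realVec w)) ?_
    · have h1 : R ⁻¹' interior O ⊆ interior (R ⁻¹' O) :=
        interior_maximal (Set.preimage_mono interior_subset)
          (isOpen_interior.preimage R.continuous_of_finiteDimensional)
      obtain ⟨y, hy⟩ := hint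
      refine ⟨R' y, h1 ?_⟩
      rw [Set.mem_preimage, hRR']
      exact hy
    · intro s hs
      change R _ ∈ O
      rw [map_add, hRR', map_smul]
      have h1 : R (Pi.single 0 1) = realVec (e (Pi.single 0 1)) := by
        rw [← hMe, realVec_mulVec, realVec_single]
        rfl
      have h2 : realVec w = (k : ℝ) • realVec (e (Pi.single 0 1)) := by
        ext j
        simpa using congrArg (Int.cast : ℤ → ℝ) (congrFun hwk j)
      have hk0 : (k : ℝ) ≠ 0 := by exact_mod_cast hk
      have hk1 : 1 ≤ |(k : ℝ)| := by exact_mod_cast Int.one_le_abs hk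
      have h3 : |s / k| ≤ 2 * N := by
        rw [abs_div, div_le_iff₀ (by linarith)]
        nlinarith
      rw [abs_le] at h3
      have h4 : s • R (Pi.single 0 1) = (s / k) • realVec w := by
        rw [h1, h2, smul_smul, div_mul_cancel₀ _ hk0]
      rw [h4]
      convert hO ha haw (show 0 ≤ 1 / 2 - s / k / (4 * N) from ?_)
        (show 0 ≤ 1 / 2 + s / k / (4 * N) from ?_) (by ring) using 1
      · have h5 : s / k = (s / k / (4 * N)) * (4 * N) := by field_simp
        rw [h5]
        generalize s / k / (4 * N) = t
        ext j
        simp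
        have : t * (4 * N) / (4 * N) = t := by field_simp
        rw [this]; ring
      · rw [sub_nonneg, div_le_iff₀ (by positivity)]; linarith
      · rw [← neg_le_iff_add_nonneg', le_div_iff₀ (by positivity)]; linarith

/-- A convex set of infinite width contains integral points `p` and `p + w i` with the `w i`
spanning `ℤ^q`. -/
theorem InfiniteWidth.exists_unimodular {q : ℕ} {O : Set (Fin q → ℝ)} (hO : Convex ℝ O)
    (hint : (interior O).Nonempty) (hw : InfiniteWidth O) :
    ∃ p : Fin q → ℤ, realVec p ∈ O ∧ ∃ w : Fin q → (Fin q → ℤ),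
      Submodule.span ℤ (Set.range w) = ⊤ ∧ ∀ i, realVec (p + w i) ∈ O := by
  obtain ⟨x, hx, w, hspan, hdil⟩ := hw.containsDilate hO hint (show (0 : ℝ) < q + 1 by positivity)
  have hreal : ∃ ξ : Fin q → ℝ, x = ∑ j, ξ j • realVec (w j) := by
    have h1 : ∀ i, ∃ c : Fin q → ℤ, ∑ j, c j • w j = Pi.single i 1 := fun i =>
      (Submodule.mem_span_range_iff_exists_fun ℤ).1 (hspan ▸ Submodule.mem_top)
    choose c hc using h1
    refine ⟨fun j => ∑ i, x i * c i j, ?_⟩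
    ext l
    have h2 : ∀ i, ∑ j, (c i j : ℝ) * w j l = if l = i then 1 else 0 := by
      intro i
      have := congrArg (Int.cast : ℤ → ℝ) (congrFun (hc i) l)
      simpa [Pi.single_apply] using this
    simp only [Finset.sum_apply, Pi.smul_apply, smul_eq_mul, Finset.sum_mul]
    rw [Finset.sum_comm]
    simp only [realVec_apply, mul_assoc, ← Finset.mul_sum, h2]
    simp
  obtain ⟨ξ, hξ⟩ := hreal
  have hcomb : ∀ c : Fin q → ℝ, (∀ j, 0 ≤ c j) → ∑ j, c j ≤ q + 1 →
      x + ∑ j, c j • realVec (w j) ∈ O := by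
    intro c hc0 hc1
    have hq : (0 : ℝ) < q + 1 := by positivity
    have := hO.sum_mem (t := Finset.univ)
      (w := fun o : Option (Fin q) => o.elim (1 - ∑ j, c j / (q + 1)) fun j => c j / (q + 1))
      (z := fun o : Option (Fin q) => o.elim x fun j => x + ((q : ℝ) + 1) • realVec (w j))
      (by
        rintro (_ | j) -
        · simp only [Option.elim]
          rw [← Finset.sum_div, sub_nonneg, div_le_one hq]
          exact hc1
        · exact div_nonneg (hc0 j) hq.le)
      (by simp)
      (by
        rintro (_ | j) -
        · exact hx
        · exact hdil j)
    convert this using 1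
    have h3 : ∀ j, (c j / (q + 1)) • (x + ((q : ℝ) + 1) • realVec (w j)) =
        (c j / (q + 1)) • x + c j • realVec (w j) := by
      intro j
      rw [smul_add, smul_smul, div_mul_cancel₀ _ hq.ne']
    simp only [Fintype.sum_option, Option.elim, h3, Finset.sum_add_distrib, ← Finset.sum_smul]
    rw [← add_assoc, ← add_smul]
    simp
  have hc : ∀ j, 0 ≤ (⌈ξ j⌉ : ℝ) - ξ j := fun j => sub_nonneg.2 (Int.le_ceil _)
  have hc1 : ∀ j, (⌈ξ j⌉ : ℝ) - ξ j ≤ 1 := fun j => by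
    have := Int.ceil_lt_add_one (ξ j); linarith
  have hsum : ∑ j, ((⌈ξ j⌉ : ℝ) - ξ j) ≤ q := by
    simpa using Finset.sum_le_sum fun j (_ : j ∈ Finset.univ) => hc1 j
  have hp : realVec (∑ j, ⌈ξ j⌉ • w j) = x + ∑ j, ((⌈ξ j⌉ : ℝ) - ξ j) • realVec (w j) := by
    rw [hξ, ← Finset.sum_add_distrib]
    ext l
    simp only [Finset.sum_apply, Pi.add_apply, Pi.smul_apply, smul_eq_mul, realVec_apply]
    push_cast
    exact Finset.sum_congr rfl fun j _ => by ring
  refine ⟨∑ j, ⌈ξ j⌉ • w j, ?_, w, hspan, fun i => ?_⟩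
  · rw [hp]
    exact hcomb _ hc (by linarith)
  · have h4 := hcomb (fun j => ((⌈ξ j⌉ : ℝ) - ξ j) + if j = i then 1 else 0)
      (fun j => add_nonneg (hc j) (by split_ifs <;> norm_num))
      (by rw [Finset.sum_add_distrib, Finset.sum_ite_eq' Finset.univ i]; simpa using hsum)
    convert h4 using 1
    rw [realVec_add, hp]
    simp only [add_smul, Finset.sum_add_distrib, ite_smul, one_smul, zero_smul,
      Finset.sum_ite_eq', Finset.mem_univ, if_true, add_assoc]

/-- Every element of the group that lies in the real cone of `H` (tested on integral linear
functionals) lies in the monoid generated by `H`. -/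
def IsNormalSet {Λ : Type} [AddCommGroup Λ] (H : Set Λ) : Prop :=
  ∀ (ι : Type) [Fintype ι] (p : ι → Λ) (c : ι → ℝ) (x : Λ), (∀ i, p i ∈ H) → (∀ i, 0 ≤ c i) →
    (∀ φ : Λ →ₗ[ℤ] ℤ, (φ x : ℝ) = ∑ i, c i * φ (p i)) → x ∈ AddSubmonoid.closure H

section Normal

variable {Λ : Type} [AddCommGroup Λ] {H : Set Λ}

theorem IsNormalSet.exists_add_mem_closure (hH : IsNormalSet H) {ι : Type} [Fintype ι]
    (p : ι → Λ) (c : ι → ℝ) (hp : ∀ i, p i ∈ H) (hc : ∀ i, 0 ≤ c i)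
    (B : Finset Λ) (hB : ∀ e ∈ B, e ∈ H) (d : Λ → ℝ) (x : Λ)
    (hx : ∀ φ : Λ →ₗ[ℤ] ℤ, (φ x : ℝ) = ∑ i, c i * φ (p i) + ∑ e ∈ B, d e * φ e) :
    ∃ y ∈ Submodule.span ℤ (B : Set Λ), x + y ∈ AddSubmonoid.closure H := by
  refine ⟨∑ e ∈ B, ⌈|d e|⌉ • e, Submodule.sum_mem _ fun e he =>
    Submodule.smul_mem _ _ (Submodule.subset_span he), ?_⟩
  refine hH (ι ⊕ B) (Sum.elim p (fun e => e)) (Sum.elim c fun e => d e + ⌈|d e|⌉) _ ?_ ?_ ?_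
  · rintro (i | e)
    · exact hp i
    · exact hB e e.2
  · rintro (i | e)
    · exact hc i
    · have h1 := Int.le_ceil |d e|
      have h2 := neg_abs_le (d e)
      simp only [Sum.elim_inr]
      linarith
  · intro φ
    simp only [map_add, map_sum, map_smul, Int.cast_add, Int.cast_sum, hx, Fintype.sum_sum_type,
      Sum.elim_inl, Sum.elim_inr, add_assoc, smul_eq_mul, Int.cast_mul, add_mul,
      Finset.sum_add_distrib]
    rw [Finset.sum_coe_sort B fun e => d e * (φ e : ℝ),
      Finset.sum_coe_sort B fun e => (⌈|d e|⌉ : ℝ) * (φ e : ℝ)]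

variable {n : Λ →ₗ[ℤ] ℤ}

theorem closure_face (hn : ∀ x ∈ H, 0 ≤ n x) {y : Λ} (hy : y ∈ AddSubmonoid.closure H) :
    0 ≤ n y ∧ (n y = 0 → y ∈ AddSubmonoid.closure (H ∩ {x | n x = 0})) ∧
      (n y = 1 → ∃ h ∈ H, n h = 1 ∧ ∃ z ∈ AddSubmonoid.closure (H ∩ {x | n x = 0}),
        y = h + z) := by
  induction hy using AddSubmonoid.closure_induction with
  | mem x hx =>
    exact ⟨hn x hx, fun h => AddSubmonoid.subset_closure ⟨hx, h⟩,
      fun h => ⟨x, hx, h, 0, zero_mem _, (add_zero x).symm⟩⟩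
  | zero => exact ⟨by simp, fun _ => zero_mem _, fun h => by simp at h⟩
  | add x y _ _ ihx ihy =>
    obtain ⟨hx0, hx1, hx2⟩ := ihx
    obtain ⟨hy0, hy1, hy2⟩ := ihy
    rw [map_add]
    refine ⟨add_nonneg hx0 hy0, fun h => add_mem (hx1 (by omega)) (hy1 (by omega)), fun h => ?_⟩
    rcases (show (n x = 1 ∧ n y = 0) ∨ (n x = 0 ∧ n y = 1) by omega) with ⟨h1, h2⟩ | ⟨h1, h2⟩
    · obtain ⟨a, ha, ha1, z, hz, rfl⟩ := hx2 h1
      exact ⟨a, ha, ha1, z + y, add_mem hz (hy1 h2), by abel⟩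
    · obtain ⟨a, ha, ha1, z, hz, rfl⟩ := hy2 h2
      exact ⟨a, ha, ha1, z + x, add_mem hz (hx1 h1), by abel⟩

theorem mem_span_of_mem_closure {F : Set Λ} {y : Λ} (hy : y ∈ AddSubmonoid.closure F) :
    y ∈ Submodule.span ℤ F :=
  (AddSubmonoid.closure_le (S := (Submodule.span ℤ F).toAddSubmonoid)).2 Submodule.subset_span hy

theorem mem_closure_preimage_span {F : Set Λ} {x : Submodule.span ℤ F}
    (hx : (x : Λ) ∈ AddSubmonoid.closure F) :
    x ∈ AddSubmonoid.closure (Subtype.val ⁻¹' F : Set (Submodule.span ℤ F)) := by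
  have h3 : F = (Submodule.span ℤ F).subtype.toAddMonoidHom ''
      (Subtype.val ⁻¹' F : Set (Submodule.span ℤ F)) := by
    ext y
    constructor
    · exact fun hy => ⟨⟨y, Submodule.subset_span hy⟩, hy, rfl⟩
    · rintro ⟨z, hz, rfl⟩
      exact hz
  obtain ⟨z, hz, hzx⟩ : (x : Λ) ∈ (AddSubmonoid.closure (Subtype.val ⁻¹' F)).map
      (Submodule.span ℤ F).subtype.toAddMonoidHom := by
    rw [AddMonoidHom.map_mclosure, ← h3]
    exact hx
  have : z = x := Subtype.ext hzx
  rwa [← this]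

theorem IsNormalSet.face (hH : IsNormalSet H) (hn : ∀ x ∈ H, 0 ≤ n x) :
    IsNormalSet (Subtype.val ⁻¹' (H ∩ {x | n x = 0}) :
      Set (Submodule.span ℤ (H ∩ {x | n x = 0}))) := by
  set F := H ∩ {x | n x = 0}
  intro ι _ p c x hp hc hx
  have h1 : (x : Λ) ∈ AddSubmonoid.closure H :=
    hH ι (fun i => p i) c x (fun i => (hp i).1) hc fun φ =>
      hx (φ.comp (Submodule.span ℤ F).subtype)
  have h0 : Submodule.span ℤ F ≤ LinearMap.ker n := Submodule.span_le.2 fun y hy => hy.2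
  exact mem_closure_preimage_span ((closure_face hn h1).2.1 (h0 x.2))

theorem IsNormalSet.saturated_face (hH : IsNormalSet H) (hn : ∀ x ∈ H, 0 ≤ n x)
    (B : Finset Λ) (hB : (B : Set Λ) ⊆ H ∩ {x | n x = 0})
    (hspan : Submodule.span ℤ (B : Set Λ) = Submodule.span ℤ (H ∩ {x | n x = 0}))
    {k : ℤ} (hk : k ≠ 0) {x : Λ} (hx : k • x ∈ Submodule.span ℤ (H ∩ {x | n x = 0})) :
    x ∈ Submodule.span ℤ (H ∩ {x | n x = 0}) := by
  have h0 : Submodule.span ℤ (H ∩ {x | n x = 0}) ≤ LinearMap.ker n :=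
    Submodule.span_le.2 fun y hy => hy.2
  have hnx : n x = 0 := by
    have := h0 hx
    rw [LinearMap.mem_ker, map_smul, smul_eq_mul] at this
    exact (mul_eq_zero.1 this).resolve_left hk
  obtain ⟨a, -, ha⟩ := Submodule.mem_span_finset.1 (hspan ▸ hx)
  obtain ⟨y, hy, hxy⟩ := hH.exists_add_mem_closure (ι := Empty) (fun e => e.elim) (fun e => e.elim)
    (fun e => e.elim) (fun e => e.elim) B (fun e he => (hB he).1) (fun e => a e / k) x (by
      intro φ
      have h1 : ((k * φ x : ℤ) : ℝ) = (∑ e ∈ B, a e * φ e : ℤ) := by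
        congr 1
        simpa using congrArg φ ha.symm
      have hk' : (k : ℝ) ≠ 0 := by exact_mod_cast hk
      have h2 : ∀ e, (a e / k : ℝ) * φ e = (a e * φ e) / k := fun e => by ring
      simp only [Finset.univ_eq_empty, Finset.sum_empty, zero_add, h2, ← Finset.sum_div]
      rw [eq_div_iff hk']
      push_cast at h1
      linarith)
  rw [hspan] at hy
  have h3 := (closure_face hn hxy).2.1 (by rw [map_add, hnx, LinearMap.mem_ker.1 (h0 hy), add_zero])
  simpa using Submodule.sub_mem _ (mem_span_of_mem_closure h3) hy

end Normal

/-- Coordinates on a finite free `ℤ`-module adapted to a saturated submodule `E` and a functional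
`n` vanishing on `E`. -/
theorem exists_adapted_coordinates {Λ : Type} [AddCommGroup Λ] [Module.Free ℤ Λ]
    [Module.Finite ℤ Λ] (E : Submodule ℤ Λ) (hE : ∀ (k : ℤ) (x : Λ), k ≠ 0 → k • x ∈ E → x ∈ E)
    (n : Λ →ₗ[ℤ] ℤ) (hn : E ≤ LinearMap.ker n) (u : Λ) (hu : n u = 1) :
    ∃ (q : ℕ) (c : Λ →ₗ[ℤ] (Fin q → ℤ)) (e : Fin q → Λ), c u = 0 ∧ (∀ i, n (e i) = 0) ∧
      (∀ i, c (e i) = Pi.single i 1) ∧ (∀ x ∈ E, c x = 0) ∧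
      (∀ x, n x = 0 → c x = 0 → x ∈ E) ∧
      q + 1 + Module.finrank ℤ E = Module.finrank ℤ Λ := by
  have : Module.IsTorsionFree ℤ (Λ ⧸ E) := by
    refine Module.IsTorsionFree.of_smul_eq_zero fun k x h => ?_
    obtain ⟨x, rfl⟩ := E.mkQ_surjective x
    by_cases hk : k = 0
    · exact Or.inl hk
    · right
      rw [← map_smul, Submodule.mkQ_apply, Submodule.Quotient.mk_eq_zero] at h
      rw [Submodule.mkQ_apply, Submodule.Quotient.mk_eq_zero]
      exact hE k x hk h
  let nb : (Λ ⧸ E) →ₗ[ℤ] ℤ := E.liftQ n hn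
  have hnb : ∀ x, nb (E.mkQ x) = n x := fun x => rfl
  let K := LinearMap.ker nb
  let b := Module.finBasis ℤ K
  let g : Λ →ₗ[ℤ] (Λ ⧸ E) := E.mkQ - (n.smulRight (E.mkQ u))
  have hg : ∀ x, g x ∈ K := by
    intro x
    simp only [K, LinearMap.mem_ker, g, LinearMap.sub_apply, LinearMap.smulRight_apply, map_sub,
      map_smul, hnb, hu]
    simp
  choose e he using fun i => E.mkQ_surjective (b i : Λ ⧸ E)
  have hne : ∀ i, n (e i) = 0 := fun i => by
    rw [← hnb, he]
    exact (b i).2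
  let c : Λ →ₗ[ℤ] (Fin (Module.finrank ℤ K) → ℤ) := b.equivFun.toLinearMap ∘ₗ g.codRestrict K hg
  have hc0 : ∀ x, c x = 0 ↔ g x = 0 := by
    intro x
    simp only [c, LinearMap.comp_apply, LinearEquiv.coe_coe, LinearEquiv.map_eq_zero_iff]
    rw [← Subtype.coe_inj]
    rfl
  refine ⟨Module.finrank ℤ K, c, e, ?_, hne, ?_, ?_, ?_, ?_⟩
  · rw [hc0]
    simp [g, hu]
  · intro i
    have h1 : g.codRestrict K hg (e i) = b i := by
      apply Subtype.ext
      simp [g, hne, ← he]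
    simp only [c, LinearMap.comp_apply, h1, LinearEquiv.coe_coe]
    ext j
    simp [Pi.single_apply, eq_comm]
  · intro x hx
    have h1 : n x = 0 := hn hx
    rw [hc0]
    simp [g, h1, hx]
  · intro x hx hcx
    rw [hc0] at hcx
    simpa [g, hx] using hcx
  · have h1 := Submodule.finrank_quotient_add_finrank E
    have h2 := Submodule.finrank_quotient_add_finrank K
    have h3 := (nb.quotKerEquivOfSurjective (fun t => ⟨E.mkQ (t • u), by
      rw [hnb, map_smul, hu]; simp⟩)).finrank_eq
    rw [Module.finrank_self] at h3
    change Module.finrank ℤ ((Λ ⧸ E) ⧸ K) = 1 at h3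
    omega

/-- The slice `n = 1` of the cone of `H` in the coordinates `c`. -/
def slice {Λ : Type} [AddCommGroup Λ] (H : Set Λ) (n : Λ →ₗ[ℤ] ℤ) {q : ℕ}
    (c : Λ →ₗ[ℤ] (Fin q → ℤ)) : Set (Fin q → ℝ) :=
  {v | ∃ x ∈ H, 0 < n x ∧ v = ((n x : ℝ)⁻¹) • realVec (c x)}

section Slice

variable {Λ : Type} [AddCommGroup Λ] {H : Set Λ} {n : Λ →ₗ[ℤ] ℤ} {q : ℕ}
  {c : Λ →ₗ[ℤ] (Fin q → ℤ)} {e : Fin q → Λ}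

theorem exists_pos_of_span_eq_top (hspan : Submodule.span ℤ H = ⊤) (hn : ∀ x ∈ H, 0 ≤ n x)
    (hn0 : n ≠ 0) : ∃ x ∈ H, 0 < n x := by
  by_contra! h
  refine hn0 (LinearMap.ext_on hspan fun x hx => ?_)
  exact le_antisymm (h x hx) (hn x hx)

theorem interior_slice_nonempty (hspan : Submodule.span ℤ H = ⊤) (hn : ∀ x ∈ H, 0 ≤ n x)
    (hn0 : n ≠ 0) (hc : ∀ x ∈ H, n x = 0 → c x = 0) (hne : ∀ i, n (e i) = 0)
    (hce : ∀ i, c (e i) = Pi.single i 1) :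
    (interior (convexHull ℝ (slice H n c))).Nonempty := by
  obtain ⟨x₀, hx₀, hx₀'⟩ := exists_pos_of_span_eq_top hspan hn hn0
  have hV : (slice H n c).Nonempty := ⟨_, x₀, hx₀, hx₀', rfl⟩
  rw [interior_convexHull_nonempty_iff_affineSpan_eq_top,
    AffineSubspace.affineSpan_eq_top_iff_vectorSpan_eq_top_of_nonempty ℝ _ _ hV]
  by_contra hlt
  obtain ⟨f, hf0, hf⟩ := Submodule.exists_le_ker_of_lt_top _ (lt_top_iff_ne_top.2 hlt)
  obtain ⟨v₀, hv₀⟩ := hV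
  have hconst : ∀ v ∈ slice H n c, f v = f v₀ := by
    intro v hv
    have := hf (vsub_mem_vectorSpan ℝ hv hv₀)
    rwa [LinearMap.mem_ker, vsub_eq_sub, map_sub, sub_eq_zero] at this
  have hH : ∀ x ∈ H, f (realVec (c x)) = f v₀ * n x := by
    intro x hx
    rcases (hn x hx).eq_or_lt with h | h
    · have h1 : realVec (0 : Fin q → ℤ) = 0 := by ext i; simp
      rw [hc x hx h.symm, ← h, h1]
      simp
    · have h1 : (n x : ℝ) ≠ 0 := by exact_mod_cast h.ne'
      have := hconst _ ⟨x, hx, h, rfl⟩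
      rw [map_smul, smul_eq_mul] at this
      rw [← this]
      field_simp
  have hall : ∀ x, f (realVec (c x)) = f v₀ * n x := by
    intro x
    have hx : x ∈ Submodule.span ℤ H := hspan ▸ Submodule.mem_top
    induction hx using Submodule.span_induction with
    | mem x hx => exact hH x hx
    | zero =>
      have h1 : realVec (0 : Fin q → ℤ) = 0 := by ext i; simp
      rw [map_zero, map_zero, h1]
      simp
    | add x y _ _ hx hy => rw [map_add, map_add, realVec_add, map_add, hx, hy]; push_cast; ring
    | smul a x _ hx =>
      have h1 : realVec (a • c x) = (a : ℝ) • realVec (c x) := by ext i; simp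
      rw [map_smul, map_smul, h1, map_smul, hx, smul_eq_mul, smul_eq_mul]
      push_cast; ring
  apply hf0
  apply LinearMap.pi_ext'
  intro i
  ext
  have := hall (e i)
  rw [hce, realVec_single, hne] at this
  simpa using this

theorem infiniteWidth_slice (hspan : Submodule.span ℤ H = ⊤) (hn : ∀ x ∈ H, 0 ≤ n x)
    (hn0 : n ≠ 0) (hbdd : ∃ A : ℤ, ∀ x ∈ H, n x ≤ A)
    (hmax : ∀ n' : Λ →ₗ[ℤ] ℤ, n' ≠ 0 → (∀ x ∈ H, 0 ≤ n' x) → (∃ A : ℤ, ∀ x ∈ H, n' x ≤ A) →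
      ¬ Submodule.span ℤ (H ∩ {x | n x = 0}) < Submodule.span ℤ (H ∩ {x | n' x = 0}))
    (hc : ∀ x ∈ H, n x = 0 → c x = 0) (hne : ∀ i, n (e i) = 0)
    (hce : ∀ i, c (e i) = Pi.single i 1) :
    InfiniteWidth (convexHull ℝ (slice H n c)) := by
  rintro m hm ⟨A, hA⟩
  obtain ⟨D, hD⟩ := hbdd
  let μ : Λ →ₗ[ℤ] ℤ := ∑ i, m i • (LinearMap.proj i ∘ₗ c)
  have hμ : ∀ x, μ x = ∑ i, m i * c x i := by
    intro x; simp [μ, LinearMap.sum_apply]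
  have hμ0 : ∀ x ∈ H, n x = 0 → μ x = 0 := by
    intro x hx h
    rw [hμ, hc x hx h]; simp
  have hμe : ∀ i, μ (e i) = m i := by
    intro i
    rw [hμ, hce]
    simp [Pi.single_apply]
  have hμb : ∀ x ∈ H, |(μ x : ℝ)| ≤ |A| * D := by
    intro x hx
    rcases (hn x hx).eq_or_lt with h | h
    · rw [hμ0 x hx h.symm]
      have : (0 : ℝ) ≤ D := by exact_mod_cast (hn x hx).trans (hD x hx)
      simpa using mul_nonneg (abs_nonneg A) this
    · have h1 : (0 : ℝ) < n x := by exact_mod_cast h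
      have h2 := hA _ (subset_convexHull ℝ _ ⟨x, hx, h, rfl⟩)
      have h3 : realVec m ⬝ᵥ ((n x : ℝ)⁻¹ • realVec (c x)) = (n x : ℝ)⁻¹ * μ x := by
        rw [dotProduct_smul, smul_eq_mul, hμ]
        simp [dotProduct]
      rw [h3, abs_mul, abs_inv, abs_of_pos h1, inv_mul_le_iff₀ h1] at h2
      have h4 : (n x : ℝ) ≤ D := by exact_mod_cast hD x hx
      calc _ ≤ n x * A := h2
        _ ≤ n x * |A| := by gcongr; exact le_abs_self A
        _ ≤ D * |A| := by gcongr
        _ = _ := mul_comm _ _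
  obtain ⟨Z, hZ⟩ := exists_nat_ge (|A| * D)
  have hμZ : ∀ x ∈ H, |μ x| ≤ Z := by
    intro x hx
    have := (hμb x hx).trans hZ
    exact_mod_cast this
  let S : Set (ℤ × ℤ) := {t | ∃ x ∈ H, 0 < n x ∧ t = (n x, μ x)}
  have hSfin : S.Finite := by
    refine ((Set.finite_Icc (0 : ℤ) D).prod (Set.finite_Icc (-(Z : ℤ)) Z)).subset ?_
    rintro _ ⟨x, hx, h, rfl⟩
    exact ⟨⟨h.le, hD x hx⟩, abs_le.1 (hμZ x hx)⟩
  obtain ⟨x₀, hx₀, hx₀'⟩ := exists_pos_of_span_eq_top hspan hn hn0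
  obtain ⟨_, ⟨y, hy, hy0, rfl⟩, hmin⟩ := Set.exists_min_image S (fun t => (t.2 / t.1 : ℚ)) hSfin
    ⟨_, x₀, hx₀, hx₀', rfl⟩
  let n' : Λ →ₗ[ℤ] ℤ := n y • μ - μ y • n
  have hn' : ∀ x, n' x = n y * μ x - μ y * n x := fun x => rfl
  have hn'0 : ∀ x ∈ H, n x = 0 → n' x = 0 := by
    intro x hx h
    rw [hn', hμ0 x hx h, h]; simp
  have hn'nonneg : ∀ x ∈ H, 0 ≤ n' x := by
    intro x hx
    rcases (hn x hx).eq_or_lt with h | h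
    · exact (hn'0 x hx h.symm).ge
    · have h1 := hmin _ ⟨x, hx, h, rfl⟩
      have h2 : (0 : ℚ) < n x := by exact_mod_cast h
      have h3 : (0 : ℚ) < n y := by exact_mod_cast hy0
      simp only at h1
      rw [div_le_div_iff₀ h3 h2] at h1
      have h4 : μ y * n x ≤ μ x * n y := by exact_mod_cast h1
      rw [hn']
      linarith
  refine hmax n' ?_ hn'nonneg ⟨n y * Z + |μ y| * D, fun x hx => ?_⟩ ?_
  · intro h
    apply hm
    ext i
    have := LinearMap.congr_fun h (e i)
    rw [hn', hμe, hne] at this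
    simpa [hy0.ne'] using this
  · rw [hn']
    have h1 : n y * μ x ≤ n y * Z :=
      mul_le_mul_of_nonneg_left ((le_abs_self _).trans (hμZ x hx)) hy0.le
    have h2 : -(μ y * n x) ≤ |μ y| * D := by
      calc _ ≤ |μ y * n x| := neg_le_abs _
        _ = |μ y| * n x := by rw [abs_mul, abs_of_nonneg (hn x hx)]
        _ ≤ _ := by gcongr; exact hD x hx
    linarith
  · refine lt_of_le_of_ne (Submodule.span_mono fun x hx => ⟨hx.1, hn'0 x hx.1 hx.2⟩) fun h => ?_
    have h1 : y ∈ Submodule.span ℤ (H ∩ {x | n' x = 0}) :=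
      Submodule.subset_span ⟨hy, (hn' y).trans (by ring)⟩
    rw [← h] at h1
    have h0 : Submodule.span ℤ (H ∩ {x | n x = 0}) ≤ LinearMap.ker n :=
      Submodule.span_le.2 fun y hy => hy.2
    exact hy0.ne' (h0 h1)

theorem IsNormalSet.exists_mem_of_mem_slice (hH : IsNormalSet H) (hn : ∀ x ∈ H, 0 ≤ n x)
    (B : Finset Λ) (hB : (B : Set Λ) ⊆ H ∩ {x | n x = 0})
    (hspan : Submodule.span ℤ (B : Set Λ) = Submodule.span ℤ (H ∩ {x | n x = 0}))
    {u : Λ} (hu : n u = 1) (hcu : c u = 0)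
    (hne : ∀ i, n (e i) = 0) (hce : ∀ i, c (e i) = Pi.single i 1)
    (hcE : ∀ x ∈ Submodule.span ℤ (H ∩ {x | n x = 0}), c x = 0)
    (hE : ∀ x, n x = 0 → c x = 0 → x ∈ Submodule.span ℤ (H ∩ {x | n x = 0}))
    {P : Fin q → ℤ} (hP : realVec P ∈ convexHull ℝ (slice H n c)) :
    ∃ h ∈ H, n h = 1 ∧ c h = P := by
  obtain ⟨ι, _, w, z, hw, hw1, hz, hwz⟩ := mem_convexHull_iff_exists_fintype.1 hP
  choose x hxH hx0 hzx using hz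
  have hx0' : ∀ i, (n (x i) : ℝ) ≠ 0 := fun i => by exact_mod_cast (hx0 i).ne'
  have hdecomp : ∀ y : Λ, ∃ a : Λ → ℤ,
      y = ∑ b ∈ B, a b • b + (n y • u + ∑ j, c y j • e j) := by
    intro y
    have h1 : y - (n y • u + ∑ j, c y j • e j) ∈ Submodule.span ℤ (B : Set Λ) := by
      rw [hspan]
      apply hE
      · simp [hu, hne]
      · ext i
        simp [hcu, hce, Finset.sum_apply, Pi.single_apply]
    obtain ⟨a, -, ha⟩ := Submodule.mem_span_finset.1 h1
    exact ⟨a, by rw [ha]; abel⟩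
  choose a ha using hdecomp
  let X : Λ := u + ∑ j, P j • e j
  have hnX : n X = 1 := by simp [X, hu, hne]
  have hcX : c X = P := by
    ext i
    simp [X, hcu, hce, Finset.sum_apply, Pi.single_apply]
  have hPj : ∀ j, ∑ i, w i / n (x i) * c (x i) j = P j := by
    intro j
    have := congrFun hwz j
    simp only [hzx, Finset.sum_apply, Pi.smul_apply, smul_eq_mul, realVec_apply] at this
    rw [← this]
    exact Finset.sum_congr rfl fun i _ => by ring
  obtain ⟨y, hy, hXy⟩ := hH.exists_add_mem_closure x (fun i => w i / n (x i)) hxH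
    (fun i => div_nonneg (hw i) (by exact_mod_cast (hx0 i).le)) B (fun b hb => (hB hb).1)
    (fun b => -∑ i, w i / n (x i) * a (x i) b) X (by
      intro φ
      have h1 : ∀ y, (φ y : ℝ) = ∑ b ∈ B, (a y b : ℝ) * φ b +
          (n y * φ u + ∑ j, (c y j : ℝ) * φ (e j)) := by
        intro y
        have := congrArg (fun t => (φ t : ℝ)) (ha y)
        simpa using this
      have h2 : ∑ i, w i / n (x i) * (φ (x i) : ℝ) =
          ∑ b ∈ B, (∑ i, w i / n (x i) * a (x i) b) * φ b + (φ u + ∑ j, (P j : ℝ) * φ (e j)) := by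
        simp only [h1 (x _), mul_add, Finset.sum_add_distrib, ← hPj]
        congr 1
        · simp only [Finset.mul_sum, Finset.sum_mul]
          rw [Finset.sum_comm]
          exact Finset.sum_congr rfl fun _ _ => Finset.sum_congr rfl fun _ _ => by ring
        congr 1
        · have : ∀ i, w i / n (x i) * (n (x i) * (φ u : ℝ)) = w i * φ u := by
            intro i
            have := hx0' i
            field_simp
          simp only [this, ← Finset.sum_mul, hw1, one_mul]
        · simp only [Finset.mul_sum, Finset.sum_mul]
          rw [Finset.sum_comm]
          exact Finset.sum_congr rfl fun _ _ => Finset.sum_congr rfl fun _ _ => by ring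
      rw [h2]
      simp [X])
  rw [hspan] at hy
  have h0 : Submodule.span ℤ (H ∩ {x | n x = 0}) ≤ LinearMap.ker n :=
    Submodule.span_le.2 fun y hy => hy.2
  obtain ⟨h, hh, hh1, t, ht, hXt⟩ := (closure_face hn hXy).2.2 (by
    rw [map_add, hnX, LinearMap.mem_ker.1 (h0 hy), add_zero])
  refine ⟨h, hh, hh1, ?_⟩
  have h5 := congrArg c hXt
  rw [map_add c X, map_add c h, hcE _ (mem_span_of_mem_closure ht), hcE _ hy, hcX, add_zero, add_zero] at h5
  exact h5.symm

end Slice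

theorem LinearMap.exists_surjective_smul {Λ : Type} [AddCommGroup Λ] {n : Λ →ₗ[ℤ] ℤ}
    (hn : n ≠ 0) : ∃ (k : ℤ) (n' : Λ →ₗ[ℤ] ℤ) (u : Λ), 0 < k ∧ n' u = 1 ∧ n = k • n' := by
  obtain ⟨g, hg⟩ := (IsPrincipalIdealRing.principal (LinearMap.range n : Ideal ℤ)).principal
  have hg0 : g ≠ 0 := by
    rintro rfl
    apply hn
    rw [Submodule.span_zero_singleton] at hg
    exact LinearMap.range_eq_bot.1 hg
  have hdvd : ∀ x, |g| ∣ n x := by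
    intro x
    have : n x ∈ Submodule.span ℤ {g} := hg ▸ LinearMap.mem_range_self n x
    rw [abs_dvd]
    exact Ideal.mem_span_singleton.1 this
  have hk : |g| ≠ 0 := abs_ne_zero.2 hg0
  obtain ⟨u, hu⟩ : |g| ∈ LinearMap.range n := by
    rw [hg]
    exact Ideal.mem_span_singleton.2 ((dvd_abs g g).2 dvd_rfl)
  choose f hf using hdvd
  let n' : Λ →ₗ[ℤ] ℤ :=
    { toFun := f
      map_add' := fun x y => mul_left_cancel₀ hk (by rw [← hf, map_add, hf x, hf y]; ring)
      map_smul' := fun a x => mul_left_cancel₀ hk (by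
        rw [← hf, map_smul, hf x, smul_eq_mul, smul_eq_mul, RingHom.id_apply]; ring) }
  refine ⟨|g|, n', u, abs_pos.2 hg0, mul_left_cancel₀ hk ?_, LinearMap.ext fun x => ?_⟩
  · rw [mul_one]
    exact (hf u).symm.trans hu
  · exact hf x

/-- A normal set spanning `Λ` and lying at height one contains a basis of `Λ`. -/
theorem IsNormalSet.exists_finset_span_eq_top {Λ : Type} [AddCommGroup Λ] [Module.Free ℤ Λ]
    [Module.Finite ℤ Λ] {H : Set Λ} (hH : IsNormalSet H) (hspan : Submodule.span ℤ H = ⊤)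
    (ht : Λ →ₗ[ℤ] ℤ) (hht : ∀ x ∈ H, ht x = 1) :
    ∃ B : Finset Λ, (B : Set Λ) ⊆ H ∧ Submodule.span ℤ (B : Set Λ) = ⊤ ∧
      B.card ≤ Module.finrank ℤ Λ := by
  induction hr : Module.finrank ℤ Λ using Nat.strong_induction_on generalizing Λ with
  | _ r ih =>
    rcases subsingleton_or_nontrivial Λ with hΛ | hΛ
    · exact ⟨∅, by simp, Subsingleton.elim _ _, by simp⟩
    let S : Set (Submodule ℤ Λ) := {E | ∃ n : Λ →ₗ[ℤ] ℤ, n ≠ 0 ∧ (∀ x ∈ H, 0 ≤ n x) ∧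
      (∃ A : ℤ, ∀ x ∈ H, n x ≤ A) ∧ E = Submodule.span ℤ (H ∩ {x | n x = 0})}
    have hht0 : ht ≠ 0 := by
      rintro rfl
      have : H = ∅ := Set.eq_empty_of_forall_notMem fun x hx => by simpa using hht x hx
      rw [this, Submodule.span_empty] at hspan
      exact bot_ne_top hspan
    obtain ⟨_, ⟨n₀, hn₀0, hn₀, ⟨A, hA⟩, rfl⟩, hmax⟩ :=
      set_has_maximal_iff_noetherian.2 (inferInstance : IsNoetherian ℤ Λ) S
        ⟨_, ht, hht0, fun x hx => by rw [hht x hx]; norm_num, ⟨1, fun x hx => (hht x hx).le⟩, rfl⟩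
    obtain ⟨k, n, u, hk, hu, rfl⟩ := LinearMap.exists_surjective_smul hn₀0
    have hker : {x | (k • n) x = 0} = {x | n x = 0} := by
      ext x
      simp [hk.ne']
    rw [hker] at hmax
    have hn : ∀ x ∈ H, 0 ≤ n x := fun x hx => nonneg_of_mul_nonneg_right (hn₀ x hx) hk
    have hbdd : ∃ A : ℤ, ∀ x ∈ H, n x ≤ A := by
      refine ⟨A, fun x hx => ?_⟩
      have h1 : k * n x ≤ A := hA x hx
      nlinarith [hn x hx]
    have hn0 : n ≠ 0 := by
      rintro rfl
      simp at hu
    set E := Submodule.span ℤ (H ∩ {x | n x = 0}) with hEdef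
    have hEker : E ≤ LinearMap.ker n := Submodule.span_le.2 fun y hy => hy.2
    have hEr : Module.finrank ℤ E < r := by
      have h1 := Submodule.finrank_quotient_add_finrank (LinearMap.ker n)
      have h2 := (n.quotKerEquivOfSurjective (fun t => ⟨t • u, by
        rw [map_smul, hu]; simp⟩)).finrank_eq
      rw [Module.finrank_self] at h2
      have h3 := Submodule.finrank_mono hEker
      omega
    obtain ⟨B', hB'H, hB'span, hB'card⟩ := ih _ hEr (hH.face hn) Submodule.span_span_coe_preimage
      (ht ∘ₗ E.subtype) (fun x hx => hht x hx.1) rfl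
    let B : Finset Λ := B'.map (Function.Embedding.subtype _)
    have hBcoe : (B : Set Λ) = E.subtype '' B' := by
      rw [Finset.coe_map]
      rfl
    have hBH : (B : Set Λ) ⊆ H ∩ {x | n x = 0} := by
      rw [hBcoe]
      rintro _ ⟨y, hy, rfl⟩
      exact hB'H hy
    have hBspan : Submodule.span ℤ (B : Set Λ) = E := by
      rw [hBcoe, ← Submodule.map_span, hB'span, Submodule.map_top, Submodule.range_subtype]
    have hBcard : B.card ≤ Module.finrank ℤ E := by simpa [B] using hB'card
    obtain ⟨q, c, e, hcu, hne, hce, hcE, hE, hrank⟩ := exists_adapted_coordinates E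
      (fun k x hk hx => hH.saturated_face hn B hBH hBspan hk hx) n hEker u hu
    have hcH : ∀ x ∈ H, n x = 0 → c x = 0 := fun x hx h =>
      hcE x (Submodule.subset_span ⟨hx, h⟩)
    obtain ⟨p, hp, w, hw, hpw⟩ := (infiniteWidth_slice hspan hn hn0 hbdd
      (fun n' h1 h2 h3 => hmax _ ⟨n', h1, h2, h3, rfl⟩) hcH hne hce).exists_unimodular
      (convex_convexHull ℝ _) (interior_slice_nonempty hspan hn hn0 hcH hne hce)
    have hlift : ∀ P : Fin q → ℤ, realVec P ∈ convexHull ℝ (slice H n c) →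
        ∃ h ∈ H, n h = 1 ∧ c h = P := fun P hP =>
      hH.exists_mem_of_mem_slice hn B hBH hBspan hu hcu hne hce hcE hE hP
    obtain ⟨h₀, hh₀, hnh₀, hch₀⟩ := hlift p hp
    choose h hh hnh hch using fun i => hlift _ (hpw i)
    let G : Finset Λ := insert h₀ (Finset.univ.image h)
    refine ⟨B ∪ G, ?_, ?_, ?_⟩
    · intro x hx
      simp only [G, Finset.coe_union, Finset.coe_insert, Finset.coe_image, Finset.coe_univ,
        Set.image_univ] at hx
      rcases hx with hx | rfl | ⟨i, rfl⟩
      · exact (hBH hx).1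
      · exact hh₀
      · exact hh i
    · set T := Submodule.span ℤ ((B ∪ G : Finset Λ) : Set Λ) with hT
      have h1 : E ≤ T := by
        rw [← hBspan]
        exact Submodule.span_mono (by simp)
      have h2 : h₀ ∈ T := Submodule.subset_span (by simp [G])
      have h3 : ∀ i, h i ∈ T := fun i => Submodule.subset_span (by simp [G])
      rw [eq_top_iff]
      intro y _
      obtain ⟨t, ht⟩ := (Submodule.mem_span_range_iff_exists_fun ℤ).1
        (hw ▸ Submodule.mem_top : c y - n y • p ∈ Submodule.span ℤ (Set.range w))
      have h4 : y - (n y • h₀ + ∑ i, t i • (h i - h₀)) ∈ E := by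
        apply hE
        · simp [hnh₀, hnh]
        · simp only [map_sub, map_add, map_smul, map_sum, hch₀, hch, add_sub_cancel_left, ht]
          abel
      have h5 : n y • h₀ + ∑ i, t i • (h i - h₀) ∈ T :=
        T.add_mem (T.smul_mem _ h2)
          (T.sum_mem fun i _ => T.smul_mem _ (T.sub_mem (h3 i) h2))
      simpa using T.add_mem (h1 h4) h5
    · have h1 := Finset.card_union_le B G
      have h2 : G.card ≤ q + 1 :=
        (Finset.card_insert_le _ _).trans (Nat.succ_le_succ (Finset.card_image_le.trans (by simp)))
      omega

theorem exists_common_den {ι : Type} [Fintype ι] (f : ι → ℚ) :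
    ∃ D : ℤ, D ≠ 0 ∧ ∃ z : ι → ℤ, ∀ i, (z i : ℚ) = D * f i := by
  refine ⟨∏ i, (f i).den, by exact_mod_cast Finset.prod_ne_zero_iff.2 fun i _ => (f i).den_nz, ?_⟩
  have h : ∀ i, ∃ z : ℤ, (z : ℚ) = ((∏ j, ((f j).den : ℤ) : ℤ) : ℚ) * f i := by
    intro i
    obtain ⟨k, hk⟩ := Finset.dvd_prod_of_mem (fun j => ((f j).den : ℤ)) (Finset.mem_univ i)
    refine ⟨k * (f i).num, ?_⟩
    have h1 : ((f i).den : ℚ) * f i = (f i).num := Rat.den_mul_eq_num (f i)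
    rw [hk]
    push_cast
    rw [← h1]
    ring
  choose z hz using h
  exact ⟨z, hz⟩

/-- A real vector `s` with `A s` a multiple of an integral vector `b` is a real combination of
integral vectors with the same property. -/
theorem exists_integral_decomposition {n m : ℕ} (A : Matrix (Fin m) (Fin n) ℤ) (b : Fin m → ℤ)
    (s : Fin n → ℝ) (t : ℝ) (hs : (A.map (Int.cast : ℤ → ℝ)).mulVec s = t • realVec b) :
    ∃ (J : Type) (_ : Fintype J) (β : J → ℝ) (g : J → (Fin n → ℤ)),
      s = ∑ j, β j • realVec (g j) ∧
      ∀ j, ∃ r : ℝ, (A.map (Int.cast : ℤ → ℝ)).mulVec (realVec (g j)) = r • realVec b := by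
  let B := Module.Basis.ofVectorSpace ℚ ℝ
  let J := Finset.univ.biUnion fun i => (B.repr (s i)).support
  have hJ : ∀ i, s i = ∑ j ∈ J, (B.repr (s i) j : ℝ) * B j := by
    intro i
    conv_lhs => rw [← B.linearCombination_repr (s i), Finsupp.linearCombination_apply]
    rw [Finsupp.sum_of_support_subset (s := J) _
      (Finset.subset_biUnion_of_mem (fun i => (B.repr (s i)).support) (Finset.mem_univ i)) _
      (by simp)]
    exact Finset.sum_congr rfl fun j _ => by rw [Rat.smul_def]
  choose D hD z hz using fun j => exists_common_den fun i => B.repr (s i) j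
  have hzR : ∀ j i, (z j i : ℝ) = D j * (B.repr (s i) j : ℝ) := fun j i => by
    exact_mod_cast congrArg (Rat.cast : ℚ → ℝ) (hz j i)
  refine ⟨J, inferInstance, fun j => B j / D j, fun j => z j, ?_, fun j => ?_⟩
  · ext i
    rw [hJ i]
    simp only [Finset.sum_apply, Pi.smul_apply, smul_eq_mul, realVec_apply, hzR]
    rw [Finset.sum_coe_sort J fun j => B j / D j * (D j * (B.repr (s i) j : ℝ))]
    refine Finset.sum_congr rfl fun j _ => ?_
    have : (D j : ℝ) ≠ 0 := by exact_mod_cast hD j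
    field_simp
  · refine ⟨D j * (B.repr t j : ℝ), ?_⟩
    ext l
    have h1 : ∑ i, A l i • s i = b l • t := by
      have := congrFun hs l
      simp only [Matrix.mulVec, dotProduct, Matrix.map_apply, Pi.smul_apply, smul_eq_mul,
        realVec_apply] at this
      simp only [zsmul_eq_mul]
      rw [this, mul_comm]
    have h2 := congrArg (fun x => ((B.repr x j : ℚ) : ℝ)) h1
    simp only [map_sum, map_zsmul, Finsupp.finsetSum_apply, Finsupp.smul_apply] at h2
    simp only [zsmul_eq_mul, Rat.cast_sum, Rat.cast_mul, Rat.cast_intCast] at h2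
    simp only [Matrix.mulVec, dotProduct, Matrix.map_apply, Pi.smul_apply, smul_eq_mul,
      realVec_apply, hzR]
    calc _ = D j * ∑ i, (A l i : ℝ) * (B.repr (s i) j : ℝ) := by
          rw [Finset.mul_sum]
          exact Finset.sum_congr rfl fun i _ => by ring
      _ = _ := by rw [h2]; ring

theorem mem_span_of_mulVec_eq_smul {n m : ℕ} {P : Set (Fin n → ℝ)} (hP : P.Nonempty)
    {A : Matrix (Fin m) (Fin n) ℝ} {b : Fin m → ℝ}
    (haff : (affineSpan ℝ P : Set (Fin n → ℝ)) = {x | A.mulVec x = b})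
    {y : Fin n → ℝ} {t : ℝ} (hy : A.mulVec y = t • b) : y ∈ Submodule.span ℝ P := by
  obtain ⟨p, hp⟩ := hP
  have hpb : p ∈ (affineSpan ℝ P : Set (Fin n → ℝ)) := subset_affineSpan ℝ P hp
  rw [haff] at hpb
  have h1 : p + (y - t • p) ∈ (affineSpan ℝ P : Set (Fin n → ℝ)) := by
    rw [haff]
    change A.mulVec _ = b
    rw [Matrix.mulVec_add, Matrix.mulVec_sub, Matrix.mulVec_smul, hy, show A.mulVec p = b from hpb]
    simp
  have hpS : p ∈ Submodule.span ℝ P := Submodule.subset_span hp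
  have h2 : p + (y - t • p) ∈ Submodule.span ℝ P := affineSpan_subset_span h1
  have h3 := Submodule.add_mem _ (Submodule.sub_mem _ h2 hpS) (Submodule.smul_mem _ t hpS)
  convert h3 using 1
  abel

/-- An integral vector in the real cone of `P` is a sum of integral points of `P`. -/
theorem IDP.mem_closure {n : ℕ} {P : Set (Fin n → ℝ)} (hIDP : IDP P)
    (ht : (Fin n → ℤ) →ₗ[ℤ] ℤ) (htR : (Fin n → ℝ) →ₗ[ℝ] ℝ)
    (hcast : ∀ x, (ht x : ℝ) = htR (realVec x)) (hP : ∀ p ∈ P, htR p = 1)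
    {ι : Type} [Fintype ι] (p : ι → (Fin n → ℝ)) (c : ι → ℝ) (hp : ∀ i, p i ∈ P)
    (hc : ∀ i, 0 ≤ c i) {x : Fin n → ℤ} (hx : realVec x = ∑ i, c i • p i) :
    x ∈ AddSubmonoid.closure {x | realVec x ∈ P} := by
  have hsum : ∑ i, c i = ht x := by
    rw [hcast, hx, map_sum]
    exact Finset.sum_congr rfl fun i _ => by rw [map_smul, hP _ (hp i), smul_eq_mul, mul_one]
  have h0 : 0 ≤ ht x := by
    have : (0 : ℝ) ≤ ht x := hsum ▸ Finset.sum_nonneg fun i _ => hc i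
    exact_mod_cast this
  obtain ⟨k, hk⟩ := Int.eq_ofNat_of_zero_le h0
  rcases Nat.eq_zero_or_pos k with rfl | hk0
  · have h1 : ∑ i, c i = 0 := by rw [hsum, hk]; simp
    have h2 := (Finset.sum_eq_zero_iff_of_nonneg fun i _ => hc i).1 h1
    have h3 : x = 0 := by
      ext j
      have := congrFun hx j
      rw [Finset.sum_eq_zero fun i hi => by rw [h2 i hi, zero_smul]] at this
      simpa using this
    rw [h3]
    exact zero_mem _
  · have hmem : realVec x ∈ scaleSet (k : ℝ) P := by
      refine ⟨Finset.univ.image p, fun y => ∑ i with p i = y, c i, ?_, ?_, ?_, ?_⟩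
      · intro y hy
        obtain ⟨i, -, rfl⟩ := Finset.mem_image.1 hy
        exact hp i
      · exact fun y => Finset.sum_nonneg fun i _ => hc i
      · rw [Finset.sum_fiberwise_of_maps_to fun i hi => Finset.mem_image_of_mem p hi, hsum, hk]
        simp
      · rw [hx, ← Finset.sum_fiberwise_of_maps_to
          (fun i (hi : i ∈ Finset.univ) => Finset.mem_image_of_mem p hi) fun i => c i • p i]
        refine Finset.sum_congr rfl fun y _ => ?_
        rw [Finset.sum_smul]
        exact Finset.sum_congr rfl fun i hi => by rw [(Finset.mem_filter.1 hi).2]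
    obtain ⟨f, hf, rfl⟩ := hIDP k hk0 x hmem
    exact AddSubmonoid.sum_mem _ fun i _ => AddSubmonoid.subset_closure (hf i)

/-- If every integral vector of the real cone of `P` is a sum of elements of `H`, then every
integral vector of the linear hull of `P` is an integral combination of elements of `H`. -/
theorem mem_span_int_of_mem_span_real {n m : ℕ} {P : Set (Fin n → ℝ)}
    {A : Matrix (Fin m) (Fin n) ℤ} {b : Fin m → ℤ}
    (haff : (affineSpan ℝ P : Set (Fin n → ℝ)) =
      {x | (A.map (Int.cast : ℤ → ℝ)).mulVec x = realVec b}) {H : Set (Fin n → ℤ)}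
    (hcone : ∀ (ι : Type) [Fintype ι] (p : ι → (Fin n → ℝ)) (c : ι → ℝ) (x : Fin n → ℤ),
      (∀ i, p i ∈ P) → (∀ i, 0 ≤ c i) → realVec x = ∑ i, c i • p i → x ∈ AddSubmonoid.closure H)
    {x : Fin n → ℤ} (hx : realVec x ∈ Submodule.span ℝ P) : x ∈ Submodule.span ℤ H := by
  rcases P.eq_empty_or_nonempty with rfl | hP
  · rw [Submodule.span_empty, Submodule.mem_bot] at hx
    have : x = 0 := by
      ext j
      simpa using congrFun hx j
    rw [this]
    exact zero_mem _
  obtain ⟨T, hTP, hTspan, hTli⟩ := exists_linearIndependent ℝ P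
  have : Fintype T := (hTli.setFinite).fintype
  have hTmem : ∀ y ∈ Submodule.span ℝ P, ∃ γ : T → ℝ, ∑ p, γ p • (p : Fin n → ℝ) = y := by
    intro y hy
    rw [← hTspan] at hy
    rw [← Submodule.mem_span_range_iff_exists_fun ℝ, Subtype.range_coe]
    exact hy
  have hTA : ∀ p : T, (A.map (Int.cast : ℤ → ℝ)).mulVec (p : Fin n → ℝ) = realVec b := by
    intro p
    have : (p : Fin n → ℝ) ∈ (affineSpan ℝ P : Set (Fin n → ℝ)) :=
      subset_affineSpan ℝ P (hTP p.2)
    rwa [haff] at this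
  obtain ⟨J, _, β, g, hs, hg⟩ := exists_integral_decomposition A b (∑ p : T, (p : Fin n → ℝ))
    (Fintype.card T) (by
      rw [Matrix.mulVec_sum]
      simp only [hTA, Finset.sum_const, Finset.card_univ]
      rw [Nat.cast_smul_eq_nsmul])
  choose γ hγ using fun j => hTmem _ (mem_span_of_mulVec_eq_smul hP haff (hg j).choose_spec)
  obtain ⟨ξ, hξ⟩ := hTmem _ hx
  let K : ℝ := ∑ p, (∑ j, |γ j p| + |ξ p|)
  have hKp : ∀ p, ∑ j, |γ j p| + |ξ p| ≤ K := fun p =>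
    Finset.single_le_sum (f := fun p => ∑ j, |γ j p| + |ξ p|)
      (fun p _ => add_nonneg (Finset.sum_nonneg fun _ _ => abs_nonneg _) (abs_nonneg _))
      (Finset.mem_univ p)
  let y : Fin n → ℤ := ∑ j, ⌊K * β j⌋ • g j
  have hy : realVec y = ∑ p : T, (K - ∑ j, Int.fract (K * β j) * γ j p) • (p : Fin n → ℝ) := by
    have h1 : realVec y = K • (∑ p : T, (p : Fin n → ℝ)) -
        ∑ j, Int.fract (K * β j) • realVec (g j) := by
      rw [hs, Finset.smul_sum, ← Finset.sum_sub_distrib]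
      ext l
      simp only [y, Int.fract, realVec_apply, Finset.sum_apply, Pi.sub_apply, Pi.smul_apply,
        smul_eq_mul]
      push_cast
      exact Finset.sum_congr rfl fun j _ => by ring
    rw [h1]
    simp only [← hγ, sub_smul, Finset.sum_sub_distrib, Finset.smul_sum, Finset.sum_smul, smul_smul]
    rw [Finset.sum_comm]
  have hbound : ∀ p, ∑ j, Int.fract (K * β j) * γ j p ≤ ∑ j, |γ j p| := by
    intro p
    refine Finset.sum_le_sum fun j _ => ?_
    have h1 := Int.fract_nonneg (K * β j)
    have h2 := (Int.fract_lt_one (K * β j)).le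
    calc _ ≤ Int.fract (K * β j) * |γ j p| := by gcongr; exact le_abs_self _
      _ ≤ 1 * |γ j p| := by gcongr
      _ = _ := one_mul _
  have hy1 : y ∈ AddSubmonoid.closure H :=
    hcone T (fun p => p) _ y (fun p => hTP p.2) (fun p => by
      have := hKp p
      have := hbound p
      have := abs_nonneg (ξ p)
      linarith) hy
  have hy2 : x + y ∈ AddSubmonoid.closure H := by
    refine hcone T (fun p => p) (fun p => ξ p + (K - ∑ j, Int.fract (K * β j) * γ j p)) (x + y)
      (fun p => hTP p.2) (fun p => ?_) ?_
    · have := hKp p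
      have := hbound p
      have := neg_abs_le (ξ p)
      linarith
    · rw [realVec_add, hy, ← hξ, ← Finset.sum_add_distrib]
      exact Finset.sum_congr rfl fun p _ => by rw [add_smul]
  simpa using Submodule.sub_mem _ (mem_span_of_mem_closure hy2) (mem_span_of_mem_closure hy1)

theorem stmt2 {n m : ℕ} (hm : 1 ≤ m) (P : Set (Fin n → ℝ))
    (A : Matrix (Fin m) (Fin n) ℤ) (b : Fin m → ℤ) (hb : b ≠ 0)
    (hgcd : Finset.univ.gcd b = 1)
    (haff : (affineSpan ℝ P : Set (Fin n → ℝ)) =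
      {x | (A.map (Int.cast : ℤ → ℝ)).mulVec x = fun i => (b i : ℝ)})
    (hIDP : IDP P) (hpointed : IsPointed P) :
    ∃ B : Finset (Fin n → ℤ),
      (∀ p ∈ B, (fun j => (p j : ℝ)) ∈ P) ∧
      LinearIndependent ℤ (fun p : {v // v ∈ B} => (p : Fin n → ℤ)) ∧
      ∀ x : Fin n → ℤ, (fun i => (x i : ℝ)) ∈ Submodule.span ℝ P →
        ∃ c : (Fin n → ℤ) → ℤ, x = ∑ h ∈ B, c h • h := by
  obtain ⟨u, hu⟩ := Finset.gcd_eq_sum_mul Finset.univ b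
  rw [hgcd] at hu
  let ht : (Fin n → ℤ) →ₗ[ℤ] ℤ := dotProductBilin ℤ ℤ u ∘ₗ A.mulVecLin
  let htR : (Fin n → ℝ) →ₗ[ℝ] ℝ :=
    dotProductBilin ℝ ℝ (realVec u) ∘ₗ (A.map (Int.cast : ℤ → ℝ)).mulVecLin
  have hcast : ∀ x, (ht x : ℝ) = htR (realVec x) := by
    intro x
    change ((u ⬝ᵥ A.mulVec x : ℤ) : ℝ) = realVec u ⬝ᵥ (A.map (Int.cast : ℤ → ℝ)).mulVec (realVec x)
    rw [← realVec_mulVec]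
    simp [dotProduct]
  have hP1 : ∀ p ∈ P, htR p = 1 := by
    intro p hp
    have h1 : p ∈ (affineSpan ℝ P : Set (Fin n → ℝ)) := subset_affineSpan ℝ P hp
    rw [haff] at h1
    change realVec u ⬝ᵥ (A.map (Int.cast : ℤ → ℝ)).mulVec p = 1
    rw [show (A.map (Int.cast : ℤ → ℝ)).mulVec p = fun i => (b i : ℝ) from h1]
    have h2 := congrArg (Int.cast : ℤ → ℝ) hu
    push_cast at h2
    rw [h2]
    exact Finset.sum_congr rfl fun i _ => mul_comm _ _
  let H : Set (Fin n → ℤ) := {x | realVec x ∈ P}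
  let E := Submodule.span ℤ H
  have hcone : ∀ (ι : Type) [Fintype ι] (p : ι → (Fin n → ℝ)) (c : ι → ℝ) (x : Fin n → ℤ),
      (∀ i, p i ∈ P) → (∀ i, 0 ≤ c i) → realVec x = ∑ i, c i • p i →
      x ∈ AddSubmonoid.closure H := fun ι _ p c x hp hc hx =>
    hIDP.mem_closure ht htR hcast hP1 p c hp hc hx
  have hnormal : IsNormalSet (Subtype.val ⁻¹' H : Set E) := by
    intro ι _ p c x hp hc hx
    refine mem_closure_preimage_span (hcone ι (fun i => realVec (p i)) c x hp hc ?_)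
    ext j
    simpa using hx (LinearMap.proj j ∘ₗ E.subtype)
  obtain ⟨B, hBH, hBspan, hBcard⟩ := hnormal.exists_finset_span_eq_top
    Submodule.span_span_coe_preimage (ht ∘ₗ E.subtype) (fun x hx => by
      have h1 : (ht x : ℝ) = 1 := by rw [hcast]; exact hP1 _ hx
      exact_mod_cast h1)
  have hli : LinearIndependent ℤ (fun v : {v // v ∈ B} => (v : E)) :=
    linearIndependent_of_top_le_span_of_card_le_finrank
      (by rw [← hBspan]; simp) (by simpa using hBcard)
  have hli' := hli.map' E.subtype (Submodule.ker_subtype E)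
  refine ⟨B.map (Function.Embedding.subtype _), ?_, ?_, fun x hx => ?_⟩
  · intro p hp
    obtain ⟨y, hy, rfl⟩ := Finset.mem_map.1 hp
    exact hBH hy
  · choose f hfB hf using fun v : {v // v ∈ B.map (Function.Embedding.subtype _)} =>
      Finset.mem_map.1 v.2
    have hinj : Function.Injective fun v => (⟨f v, hfB v⟩ : {v // v ∈ B}) := by
      intro v w hvw
      have h1 : f v = f w := congrArg (fun t : {v // v ∈ B} => (t : E)) hvw
      exact Subtype.ext (by rw [← hf v, ← hf w, h1])
    have h2 := hli'.comp _ hinj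
    have h3 : (fun p : {v // v ∈ B.map (Function.Embedding.subtype _)} => (p : Fin n → ℤ)) =
        (E.subtype ∘ fun v : {v // v ∈ B} => (v : E)) ∘
          fun v => (⟨f v, hfB v⟩ : {v // v ∈ B}) :=
      funext fun v => (hf v).symm
    rw [h3]
    exact h2
  · have hxE : x ∈ Submodule.span ℤ (B.map (Function.Embedding.subtype _) : Set (Fin n → ℤ)) := by
      have h1 := congrArg (Submodule.map E.subtype) hBspan
      rw [Submodule.map_span, Submodule.map_top, Submodule.range_subtype] at h1
      have h2 : x ∈ E := mem_span_int_of_mem_span_real haff hcone hx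
      rw [← h1] at h2
      rw [Finset.coe_map]
      exact h2
    obtain ⟨a, -, ha⟩ := Submodule.mem_span_finset.1 hxE
    exact ⟨a, ha.symm⟩
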